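/- Let d ≥ 1 be an integer, α ∈ (0,2) and r_1 ∈ (0, 1/2]. Then there exist δ ∈ (0, r_1/4] and a constant C > 0, depending only on α, d and r_1, such that for every y ∈ V_δ the principal value limit defining Δ^{α/2} h_{α/2}(y) exists and |Δ^{α/2} h_{α/2}(y)| ≤ C. -/

import Mathlib

open MeasureTheory Filter Set

/-- The constant 𝒜(d, -α) = α 2^{α-1} π^{-d/2} Γ((d+α)/2) Γ(1-α/2)^{-1}. -/
noncomputable def fracConst (d : ℕ) (α : ℝ) : ℝ :=
  α * 2 ^ (α - 1) * Real.pi ^ (-(d : ℝ) / 2) *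
    Real.Gamma (((d : ℝ) + α) / 2) / Real.Gamma (1 - α / 2)

/-- The Euclidean norm on ℝ^{m} × ℝ ≅ ℝ^{m+1}, writing y = (ỹ, y_d). -/
noncomputable def enorm' {m : ℕ} (y : EuclideanSpace ℝ (Fin m) × ℝ) : ℝ :=
  Real.sqrt (‖y.1‖ ^ 2 + y.2 ^ 2)

/-- The truncated-at-ε integral ∫_{|y-x|>ε} (u(y)-u(x)) |x-y|^{-d-α} dy on
ℝ^{d-1} × ℝ ≅ ℝ^d, whose limit as ε ↓ 0 is the principal value integral defining the
fractional Laplacian Δ^{α/2}u(x) (up to the constant `fracConst d α`). -/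
noncomputable def pvInt2 (d : ℕ) (α : ℝ)
    (u : EuclideanSpace ℝ (Fin (d - 1)) × ℝ → ℝ)
    (x : EuclideanSpace ℝ (Fin (d - 1)) × ℝ) (ε : ℝ) : ℝ :=
  ∫ y in {y : EuclideanSpace ℝ (Fin (d - 1)) × ℝ | ε < enorm' (y - x)},
    (u y - u x) / enorm' (x - y) ^ ((d : ℝ) + α)

/-- h_p(y) = (y_d - √(r₁² - |ỹ|²))^p on {r₁ < |y| < 3r₁/2, y_d > 0, |ỹ| < r₁/2},
and 0 otherwise. -/
noncomputable def hfun (d : ℕ) (r1 p : ℝ)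
    (y : EuclideanSpace ℝ (Fin (d - 1)) × ℝ) : ℝ :=
  if r1 < enorm' y ∧ enorm' y < 3 * r1 / 2 ∧ 0 < y.2 ∧ ‖y.1‖ < r1 / 2 then
    (y.2 - Real.sqrt (r1 ^ 2 - ‖y.1‖ ^ 2)) ^ p
  else 0

/-- The second difference at `1` of the power `(·)₊ ^ s`, with increment `ρ`. -/
noncomputable def secondDiffPow (s ρ : ℝ) : ℝ :=
  (max (1 + ρ) 0) ^ s + (max (1 - ρ) 0) ^ s - 2

theorem secondDiffPow_neg (s ρ : ℝ) : secondDiffPow s (-ρ) = secondDiffPow s ρ := by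
  simp only [secondDiffPow, sub_neg_eq_add, ← sub_eq_add_neg]
  ring

theorem secondDiffPow_zero (s : ℝ) : secondDiffPow s 0 = 0 := by
  norm_num [secondDiffPow]

theorem secondDiffPow_abs (s ρ : ℝ) : secondDiffPow s |ρ| = secondDiffPow s ρ := by
  rcases abs_choice ρ with h | h <;> rw [h]
  exact secondDiffPow_neg s ρ

theorem continuous_secondDiffPow {s : ℝ} (hs : 0 < s) : Continuous (secondDiffPow s) := by
  unfold secondDiffPow
  have h1 : Continuous fun ρ : ℝ => (max (1 + ρ) 0) ^ s :=
    (by fun_prop : Continuous fun ρ : ℝ => max (1 + ρ) 0).rpow_const fun _ => Or.inr hs.le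
  have h2 : Continuous fun ρ : ℝ => (max (1 - ρ) 0) ^ s :=
    (by fun_prop : Continuous fun ρ : ℝ => max (1 - ρ) 0).rpow_const fun _ => Or.inr hs.le
  fun_prop

theorem abs_secondDiffPow_le_of_le_one {s ρ : ℝ} (hs : 0 < s) (hs1 : s < 1) (h0 : 0 ≤ ρ)
    (h1 : ρ ≤ 1) : |secondDiffPow s ρ| ≤ 2 * ρ ^ 2 := by
  unfold secondDiffPow
  rw [max_eq_left (by linarith), max_eq_left (by linarith)]
  have hup := rpow_one_add_le_one_add_mul_self (s := ρ) (by linarith) hs.le hs1.le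
  have hum := rpow_one_add_le_one_add_mul_self (s := -ρ) (by linarith) hs.le hs1.le
  rw [← sub_eq_add_neg] at hum
  have hprod : (1 + ρ) ^ s * (1 - ρ) ^ s = (1 - ρ ^ 2) ^ s := by
    rw [← Real.mul_rpow (by linarith) (by linarith)]
    ring_nf
  have hlow : 1 - ρ ^ 2 ≤ (1 - ρ ^ 2) ^ s := by
    rcases eq_or_lt_of_le (show 0 ≤ 1 - ρ ^ 2 by nlinarith) with h | h
    · rw [← h, Real.zero_rpow hs.ne']
    · simpa using Real.rpow_le_rpow_of_exponent_ge h (by nlinarith) hs1.le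
  have hX : 0 ≤ (1 + ρ) ^ s := Real.rpow_nonneg (by linarith) _
  have hY : 0 ≤ (1 - ρ) ^ s := Real.rpow_nonneg (by linarith) _
  rw [abs_le]
  constructor
  · by_contra! hlt
    have hlt' : (1 + ρ) ^ s + (1 - ρ) ^ s < 2 * (1 - ρ ^ 2) := by linarith
    have : ((1 + ρ) ^ s + (1 - ρ) ^ s) ^ 2 < (2 * (1 - ρ ^ 2)) ^ 2 := by gcongr
    nlinarith [sq_nonneg ((1 + ρ) ^ s - (1 - ρ) ^ s)]
  · nlinarith

theorem abs_secondDiffPow_le_of_one_le {s ρ : ℝ} (hs : 0 < s) (hs1 : s < 1) (h1 : 1 ≤ ρ) :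
    |secondDiffPow s ρ| ≤ 2 * ρ ^ s := by
  unfold secondDiffPow
  rw [max_eq_left (by linarith), max_eq_right (by linarith), Real.zero_rpow hs.ne']
  have h2 : (1 + ρ) ^ s ≤ (2 * ρ) ^ s := Real.rpow_le_rpow (by linarith) (by linarith) hs.le
  rw [Real.mul_rpow (by norm_num) (by linarith)] at h2
  have h3 : (2 : ℝ) ^ s ≤ 2 := by
    simpa using Real.rpow_le_rpow_of_exponent_le (x := 2) (by norm_num) hs1.le
  have h4 : 1 ≤ ρ ^ s := Real.one_le_rpow h1 hs.le
  have h5 : 0 ≤ (1 + ρ) ^ s := Real.rpow_nonneg (by linarith) _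
  rw [abs_le]
  constructor <;> nlinarith

theorem abs_secondDiffPow_le {s : ℝ} (hs : 0 < s) (hs1 : s < 1) (ρ : ℝ) :
    |secondDiffPow s ρ| ≤ 2 * min (|ρ| ^ 2) (|ρ| ^ s) := by
  rw [← secondDiffPow_abs]
  rcases le_total |ρ| 1 with h | h
  · rw [min_eq_left]
    · exact abs_secondDiffPow_le_of_le_one hs hs1 (abs_nonneg _) h
    · rcases eq_or_lt_of_le (abs_nonneg ρ) with h0 | h0
      · rw [← h0, Real.zero_rpow hs.ne']; norm_num
      · have := Real.rpow_le_rpow_of_exponent_ge h0 h (show s ≤ (2 : ℕ) by push_cast; linarith)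
        rwa [Real.rpow_natCast] at this
  · rw [min_eq_right]
    · exact abs_secondDiffPow_le_of_one_le hs hs1 h
    · have := Real.rpow_le_rpow_of_exponent_le h (show s ≤ (2 : ℕ) by push_cast; linarith)
      rwa [Real.rpow_natCast] at this

theorem integrableOn_min_sq_rpow_mul_rpow {s : ℝ} (hs : 0 < s) (hs1 : s < 1) :
    IntegrableOn (fun r : ℝ => min (r ^ 2) (r ^ s) * r ^ (-1 - 2 * s)) (Ioi 0) := by
  have hmeas : Measurable (fun r : ℝ => min (r ^ 2) (r ^ s) * r ^ (-1 - 2 * s)) := by fun_prop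
  rw [← Ioc_union_Ioi_eq_Ioi zero_le_one, integrableOn_union]
  constructor
  · have : IntegrableOn (fun r : ℝ => r ^ (1 - 2 * s)) (Ioc 0 1) :=
      (intervalIntegrable_iff_integrableOn_Ioc_of_le zero_le_one).1
        (intervalIntegral.intervalIntegrable_rpow' (by linarith))
    refine this.mono' hmeas.aestronglyMeasurable ?_
    filter_upwards [ae_restrict_mem measurableSet_Ioc] with r hr
    have hr0 := hr.1
    rw [Real.norm_of_nonneg (by positivity)]
    calc _ ≤ r ^ 2 * r ^ (-1 - 2 * s) := by gcongr; exact min_le_left _ _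
      _ = r ^ (1 - 2 * s) := by
        rw [← Real.rpow_natCast, ← Real.rpow_add hr0]; push_cast; ring_nf
  · refine (integrableOn_Ioi_rpow_of_lt (show -1 - s < -1 by linarith) one_pos).mono'
      hmeas.aestronglyMeasurable ?_
    filter_upwards [ae_restrict_mem measurableSet_Ioi] with r hr
    have hr0 : 0 < r := lt_trans one_pos hr
    rw [Real.norm_of_nonneg (by positivity)]
    calc _ ≤ r ^ s * r ^ (-1 - 2 * s) := by gcongr; exact min_le_right _ _
      _ = r ^ (-1 - s) := by
        rw [← Real.rpow_add hr0]; ring_nf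

theorem integrableOn_secondDiffPow_mul_rpow {s : ℝ} (hs : 0 < s) (hs1 : s < 1) :
    IntegrableOn (fun r : ℝ => secondDiffPow s r * r ^ (-1 - 2 * s)) (Ioi 0) := by
  refine ((integrableOn_min_sq_rpow_mul_rpow hs hs1).const_mul 2).mono'
    ((continuous_secondDiffPow hs).measurable.mul (by fun_prop)).aestronglyMeasurable ?_
  filter_upwards [ae_restrict_mem measurableSet_Ioi] with r hr
  have hr0 : 0 < r := hr
  have := abs_secondDiffPow_le hs hs1 r
  rw [abs_of_pos hr0] at this
  rw [norm_mul, Real.norm_eq_abs, Real.norm_of_nonneg (by positivity), ← mul_assoc]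
  gcongr

/-- A set integral over `{ε < N}` tends to the integral over `{0 < N}`. -/
theorem tendsto_setIntegral_lt {X : Type*} [MeasurableSpace X] {μ : Measure X} {f N : X → ℝ}
    (hN : Measurable N) (hf : Integrable f μ) (h0 : ∀ x, N x ≤ 0 → f x = 0) :
    Tendsto (fun ε : ℝ => ∫ x in {x | ε < N x}, f x ∂μ) (nhdsWithin 0 (Ioi 0))
      (nhds (∫ x, f x ∂μ)) := by
  have hm : ∀ ε : ℝ, MeasurableSet {x | ε < N x} := fun ε => measurableSet_lt measurable_const hN
  simp_rw [← integral_indicator (hm _)]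
  refine tendsto_integral_filter_of_dominated_convergence (fun x => ‖f x‖)
    (.of_forall fun ε => (hf.indicator (hm ε)).aestronglyMeasurable)
    (.of_forall fun ε => .of_forall fun x => norm_indicator_le_norm_self _ _) hf.norm
    (.of_forall fun x => ?_)
  rcases le_or_gt (N x) 0 with hx | hx
  · refine tendsto_const_nhds.congr' (.of_forall fun ε => ?_)
    by_cases h : x ∈ {x | ε < N x} <;> simp [h, h0 x hx]
  · refine tendsto_const_nhds.congr' ?_
    filter_upwards [nhdsWithin_le_nhds (eventually_lt_nhds hx)] with ε hε
    rw [indicator_of_mem (show x ∈ {x | ε < N x} from hε)]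

/-- The inner part of the one-dimensional integrand. -/
noncomputable def innerDiff (s ρ : ℝ) : ℝ := ((max (1 - ρ) 0) ^ s - 1) * ρ ^ (-1 - 2 * s)

/-- The outer part of the one-dimensional integrand. -/
noncomputable def outerDiff (s ρ : ℝ) : ℝ := ((1 + ρ) ^ s - 1) * ρ ^ (-1 - 2 * s)

/-- The integrated inner part, from `x` to `1`. -/
noncomputable def innerPrimitive (s x : ℝ) : ℝ := ∫ u in x..1, innerDiff s u

/-- The explicit part of a primitive of `outerDiff`. -/
noncomputable def explicitPrimitive (s ρ : ℝ) : ℝ :=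
  ((1 + ρ) ^ s - 1) ^ 2 / (2 * s) * ρ ^ (-(2 * s))

theorem continuousOn_innerDiff {s : ℝ} (hs : 0 < s) : ContinuousOn (innerDiff s) (Ioi 0) := by
  unfold innerDiff
  have h1 : Continuous fun ρ : ℝ => (max (1 - ρ) 0) ^ s :=
    (by fun_prop : Continuous fun ρ : ℝ => max (1 - ρ) 0).rpow_const fun _ => Or.inr hs.le
  have h2 : ContinuousOn (fun ρ : ℝ => ρ ^ (-1 - 2 * s)) (Ioi 0) :=
    continuousOn_id.rpow_const fun x hx => Or.inl (ne_of_gt hx)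
  exact (h1.sub continuous_const).continuousOn.mul h2

theorem intervalIntegrable_innerDiff {s a b : ℝ} (hs : 0 < s) (ha : 0 < a) (hb : 0 < b) :
    IntervalIntegrable (innerDiff s) volume a b :=
  ((continuousOn_innerDiff hs).mono fun _ hx =>
    lt_of_lt_of_le (lt_min ha hb) hx.1).intervalIntegrable

theorem hasDerivAt_innerPrimitive {s x : ℝ} (hs : 0 < s) (hx : 0 < x) :
    HasDerivAt (innerPrimitive s) (-innerDiff s x) x :=
  intervalIntegral.integral_hasDerivAt_left (intervalIntegrable_innerDiff hs hx one_pos)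
    ((continuousOn_innerDiff hs).stronglyMeasurableAtFilter isOpen_Ioi x hx)
    ((continuousOn_innerDiff hs).continuousAt (Ioi_mem_nhds hx))

theorem hasDerivAt_outerPrimitive {s x : ℝ} (hs : 0 < s) (hx : 0 < x) :
    HasDerivAt (fun ρ => innerPrimitive s (ρ / (1 + ρ)) + explicitPrimitive s ρ)
      (outerDiff s x) x := by
  have hx1 : 0 < 1 + x := by linarith
  have hτ : HasDerivAt (fun ρ : ℝ => ρ / (1 + ρ)) (1 / (1 + x) ^ 2) x := by
    have := (hasDerivAt_id x).div ((hasDerivAt_id x).const_add 1) hx1.ne'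
    refine this.congr_deriv ?_
    simp
  have h1 := (hasDerivAt_innerPrimitive hs (div_pos hx hx1)).comp x hτ
  have hX : HasDerivAt (fun ρ : ℝ => (1 + ρ) ^ s) (s * (1 + x) ^ (s - 1)) x := by
    have := ((hasDerivAt_id x).const_add 1).rpow_const (p := s) (Or.inl hx1.ne')
    refine this.congr_deriv ?_
    simp
  have hP : HasDerivAt (fun ρ : ℝ => ρ ^ (-(2 * s))) (-(2 * s) * x ^ (-(2 * s) - 1)) x :=
    Real.hasDerivAt_rpow_const (Or.inl hx.ne')
  have h2 := (((hX.sub_const 1).pow 2).div_const (2 * s)).mul hP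
  refine (h1.add h2).congr_deriv ?_
  simp only [Pi.pow_apply]
  unfold innerDiff outerDiff
  have e1 : 1 - x / (1 + x) = (1 + x)⁻¹ := by field_simp; ring
  rw [e1, max_eq_left (by positivity), Real.inv_rpow hx1.le, Real.div_rpow hx.le hx1.le,
    Real.rpow_sub_one hx1.ne', Real.rpow_sub_one hx.ne', show -1 - 2 * s = -(2 * s) - 1 by ring,
    Real.rpow_sub_one hx.ne', Real.rpow_sub_one hx1.ne', Real.rpow_neg hx.le, Real.rpow_neg hx1.le,
    show 2 * s = s + s by ring, Real.rpow_add hx, Real.rpow_add hx1]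
  have hXp : 0 < (1 + x) ^ s := Real.rpow_pos_of_pos hx1 _
  have hYp : 0 < x ^ s := Real.rpow_pos_of_pos hx _
  generalize (1 + x) ^ s = X at *
  generalize x ^ s = Y at *
  field_simp
  ring

theorem tendsto_outerPrimitive {s : ℝ} (hs : 0 < s) :
    Tendsto (fun ρ => innerPrimitive s (ρ / (1 + ρ)) + explicitPrimitive s ρ) atTop
      (nhds (1 / (2 * s))) := by
  have h0 : Tendsto (fun ρ : ℝ => ρ⁻¹ + 1) atTop (nhds 1) := by
    simpa using (tendsto_inv_atTop_zero (𝕜 := ℝ)).add_const 1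
  have hτ : Tendsto (fun ρ : ℝ => ρ / (1 + ρ)) atTop (nhds 1) := by
    have := h0.inv₀ one_ne_zero
    rw [inv_one] at this
    refine this.congr' ?_
    filter_upwards [eventually_gt_atTop 0] with ρ hρ
    field_simp
  have h1 : Tendsto (fun ρ => innerPrimitive s (ρ / (1 + ρ))) atTop (nhds 0) := by
    have := (hasDerivAt_innerPrimitive hs one_pos).continuousAt.tendsto.comp hτ
    simpa [innerPrimitive, Function.comp_def] using this
  have h2 : Tendsto (fun ρ : ℝ => (ρ⁻¹ + 1) ^ s - ρ ^ (-s)) atTop (nhds 1) := by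
    have := (h0.rpow_const (p := s) (Or.inl one_ne_zero)).sub (tendsto_rpow_neg_atTop hs)
    simpa using this
  have h3 : Tendsto (explicitPrimitive s) atTop (nhds (1 / (2 * s))) := by
    have := (h2.pow 2).div_const (2 * s)
    rw [one_pow] at this
    refine this.congr' ?_
    filter_upwards [eventually_gt_atTop 0] with ρ hρ
    have : ρ⁻¹ + 1 = (1 + ρ) / ρ := by field_simp
    unfold explicitPrimitive
    rw [this, Real.div_rpow (by positivity) hρ.le, Real.rpow_neg hρ.le, Real.rpow_neg hρ.le,
      show 2 * s = s + s by ring, Real.rpow_add hρ]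
    have hYp : 0 < ρ ^ s := Real.rpow_pos_of_pos hρ _
    field_simp
  simpa using h1.add h3

theorem outerDiff_nonneg {s x : ℝ} (hs : 0 < s) (hx : 0 < x) : 0 ≤ outerDiff s x :=
  mul_nonneg (sub_nonneg.2 (Real.one_le_rpow (by linarith) hs.le)) (Real.rpow_nonneg hx.le _)

theorem integrableOn_outerDiff {s ε : ℝ} (hs : 0 < s) (hε : 0 < ε) :
    IntegrableOn (outerDiff s) (Ioi ε) :=
  integrableOn_Ioi_deriv_of_nonneg'
    (fun _ hx => hasDerivAt_outerPrimitive hs (hε.trans_le hx))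
    (fun _ hx => outerDiff_nonneg hs (hε.trans hx)) (tendsto_outerPrimitive hs)

theorem integral_outerDiff {s ε : ℝ} (hs : 0 < s) (hε : 0 < ε) :
    ∫ ρ in Ioi ε, outerDiff s ρ =
      1 / (2 * s) - (innerPrimitive s (ε / (1 + ε)) + explicitPrimitive s ε) :=
  integral_Ioi_of_hasDerivAt_of_nonneg'
    (fun _ hx => hasDerivAt_outerPrimitive hs (hε.trans_le hx))
    (fun _ hx => outerDiff_nonneg hs (hε.trans hx)) (tendsto_outerPrimitive hs)

theorem innerDiff_eq_of_one_lt {s x : ℝ} (hs : 0 < s) (hx : 1 < x) :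
    innerDiff s x = -x ^ (-1 - 2 * s) := by
  unfold innerDiff
  rw [max_eq_right (by linarith), Real.zero_rpow hs.ne']
  ring

theorem integrableOn_innerDiff_Ioi_one {s : ℝ} (hs : 0 < s) :
    IntegrableOn (innerDiff s) (Ioi 1) :=
  (integrableOn_congr_fun (fun _ hx => innerDiff_eq_of_one_lt hs hx) measurableSet_Ioi).2
    (integrableOn_Ioi_rpow_of_lt (by linarith) one_pos).neg

theorem integrableOn_innerDiff {s ε : ℝ} (hs : 0 < s) (hε : 0 < ε) (hε1 : ε ≤ 1) :
    IntegrableOn (innerDiff s) (Ioi ε) := by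
  rw [← Ioc_union_Ioi_eq_Ioi hε1]
  exact ((intervalIntegrable_iff_integrableOn_Ioc_of_le hε1).1
    (intervalIntegrable_innerDiff hs hε one_pos)).union (integrableOn_innerDiff_Ioi_one hs)

theorem integral_innerDiff {s ε : ℝ} (hs : 0 < s) (hε : 0 < ε) (hε1 : ε ≤ 1) :
    ∫ ρ in Ioi ε, innerDiff s ρ = innerPrimitive s ε - 1 / (2 * s) := by
  rw [← Ioc_union_Ioi_eq_Ioi hε1, setIntegral_union Ioc_disjoint_Ioi_same measurableSet_Ioi
    ((intervalIntegrable_iff_integrableOn_Ioc_of_le hε1).1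
      (intervalIntegrable_innerDiff hs hε one_pos)) (integrableOn_innerDiff_Ioi_one hs),
    ← intervalIntegral.integral_of_le hε1,
    setIntegral_congr_fun measurableSet_Ioi (fun _ hx => innerDiff_eq_of_one_lt hs hx),
    integral_neg, integral_Ioi_rpow_of_lt (by linarith) one_pos, Real.one_rpow, innerPrimitive]
  have : -1 - 2 * s + 1 = -(2 * s) := by ring
  rw [this]
  field_simp
  ring

theorem integral_Ioi_secondDiffPow {s ε : ℝ} (hs : 0 < s) (hε : 0 < ε) (hε1 : ε ≤ 1) :
    ∫ ρ in Ioi ε, secondDiffPow s ρ * ρ ^ (-1 - 2 * s) =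
      (innerPrimitive s ε - innerPrimitive s (ε / (1 + ε))) - explicitPrimitive s ε := by
  have : EqOn (fun ρ => secondDiffPow s ρ * ρ ^ (-1 - 2 * s))
      (fun ρ => outerDiff s ρ + innerDiff s ρ) (Ioi ε) := by
    intro ρ hρ
    have hρ : ε < ρ := hρ
    simp only [secondDiffPow, outerDiff, innerDiff, max_eq_left (show 0 ≤ 1 + ρ by linarith)]
    ring
  rw [setIntegral_congr_fun measurableSet_Ioi this,
    integral_add (integrableOn_outerDiff hs hε) (integrableOn_innerDiff hs hε hε1),
    integral_outerDiff hs hε, integral_innerDiff hs hε hε1]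
  ring

theorem abs_innerDiff_le {s x : ℝ} (hs : 0 < s) (hs1 : s < 1) (hx : 0 < x) (hx1 : x ≤ 1) :
    |innerDiff s x| ≤ x ^ (-(2 * s)) := by
  unfold innerDiff
  rw [max_eq_left (by linarith), abs_mul, abs_of_nonneg (Real.rpow_nonneg hx.le _),
    show -(2 * s) = 1 + (-1 - 2 * s) by ring, Real.rpow_add hx, Real.rpow_one]
  gcongr
  have h1 : (1 - x) ^ s ≤ 1 := Real.rpow_le_one (by linarith) (by linarith) hs.le
  have h2 : 1 - x ≤ (1 - x) ^ s := by
    rcases eq_or_lt_of_le (show 0 ≤ 1 - x by linarith) with h | h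
    · rw [← h, Real.zero_rpow hs.ne']
    · simpa using Real.rpow_le_rpow_of_exponent_ge h (by linarith) hs1.le
  rw [abs_le]
  constructor <;> linarith

theorem abs_innerPrimitive_sub_le {s ε : ℝ} (hs : 0 < s) (hs1 : s < 1) (hε : 0 < ε)
    (hε1 : ε ≤ 1) : |innerPrimitive s ε - innerPrimitive s (ε / (1 + ε))| ≤
      2 ^ (2 * s) * ε ^ (2 - 2 * s) := by
  have hτ : 0 < ε / (1 + ε) := by positivity
  have hτ2 : ε / 2 ≤ ε / (1 + ε) := by gcongr; linarith
  have hτε : ε / (1 + ε) ≤ ε := div_le_self hε.le (by linarith)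
  have hsub : innerPrimitive s ε - innerPrimitive s (ε / (1 + ε)) =
      - ∫ u in (ε / (1 + ε))..ε, innerDiff s u := by
    unfold innerPrimitive
    rw [← intervalIntegral.integral_add_adjacent_intervals
      (intervalIntegrable_innerDiff hs hτ hε) (intervalIntegrable_innerDiff hs hε one_pos)]
    ring
  rw [hsub, abs_neg]
  have hb := intervalIntegral.norm_integral_le_of_norm_le_const (f := innerDiff s)
    (a := ε / (1 + ε)) (b := ε) (C := (ε / 2) ^ (-(2 * s))) (fun x hx => by
      rw [uIoc_of_le hτε] at hx
      refine (abs_innerDiff_le hs hs1 (hτ.trans hx.1) (hx.2.trans hε1)).trans ?_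
      exact Real.rpow_le_rpow_of_nonpos (by positivity) (hτ2.trans hx.1.le) (by linarith))
  refine hb.trans ?_
  have hlen : |ε - ε / (1 + ε)| ≤ ε ^ 2 := by
    rw [abs_of_nonneg (by linarith)]
    have : ε - ε / (1 + ε) = ε ^ 2 / (1 + ε) := by field_simp; ring
    rw [this]
    exact div_le_self (by positivity) (by linarith)
  calc _ ≤ (ε / 2) ^ (-(2 * s)) * ε ^ 2 := by gcongr
    _ = _ := by
      rw [Real.div_rpow hε.le (by norm_num), Real.rpow_neg (by norm_num : (0 : ℝ) ≤ 2),
        Real.rpow_sub hε, Real.rpow_neg hε.le, Real.rpow_two]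
      field_simp

theorem tendsto_explicitPrimitive {s : ℝ} (hs : 0 < s) (hs1 : s < 1) :
    Tendsto (explicitPrimitive s) (nhdsWithin 0 (Ioi 0)) (nhds 0) := by
  have hlim : Tendsto (fun ε : ℝ => s / 2 * ε ^ (2 - 2 * s)) (nhdsWithin 0 (Ioi 0)) (nhds 0) := by
    have h := (Real.continuousAt_rpow_const 0 (2 - 2 * s) (Or.inr (by linarith))).tendsto
    rw [Real.zero_rpow (by linarith)] at h
    simpa using (h.const_mul (s / 2)).mono_left nhdsWithin_le_nhds
  refine squeeze_zero' ?_ ?_ hlim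
  · filter_upwards [self_mem_nhdsWithin] with ε hε
    have : 0 < ε := hε
    unfold explicitPrimitive
    positivity
  · filter_upwards [self_mem_nhdsWithin] with ε hε
    have hε0 : 0 < ε := hε
    unfold explicitPrimitive
    have h1 := rpow_one_add_le_one_add_mul_self (s := ε) (by linarith) hs.le hs1.le
    have h2 : 1 ≤ (1 + ε) ^ s := Real.one_le_rpow (by linarith) hs.le
    calc _ ≤ (s * ε) ^ 2 / (2 * s) * ε ^ (-(2 * s)) := by gcongr; linarith
      _ = _ := by
        rw [Real.rpow_sub hε0, Real.rpow_neg hε0.le, Real.rpow_two]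
        field_simp

/-- The fractional Laplacian of `(·)₊ ^ s` of order `2 s` vanishes on the positive half-line. -/
theorem integral_secondDiffPow_mul_rpow {s : ℝ} (hs : 0 < s) (hs1 : s < 1) :
    ∫ ρ in Ioi (0 : ℝ), secondDiffPow s ρ * ρ ^ (-1 - 2 * s) = 0 := by
  have hint := integrableOn_secondDiffPow_mul_rpow hs hs1
  have hext : ∀ ρ : ℝ, ρ ≤ 0 →
      (Ioi (0 : ℝ)).indicator (fun ρ => secondDiffPow s ρ * ρ ^ (-1 - 2 * s)) ρ = 0 :=
    fun ρ hρ => indicator_of_notMem (by simpa using hρ) _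
  have h := tendsto_setIntegral_lt (μ := volume) measurable_id
    ((integrable_indicator_iff measurableSet_Ioi).2 hint) hext
  rw [integral_indicator measurableSet_Ioi] at h
  refine tendsto_nhds_unique h ?_
  have hlim : Tendsto (fun ε : ℝ => 2 ^ (2 * s) * ε ^ (2 - 2 * s)) (nhdsWithin 0 (Ioi 0))
      (nhds 0) := by
    have h := (Real.continuousAt_rpow_const 0 (2 - 2 * s) (Or.inr (by linarith))).tendsto
    rw [Real.zero_rpow (by linarith)] at h
    simpa using (h.const_mul (2 ^ (2 * s))).mono_left nhdsWithin_le_nhds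
  have hone : ∀ᶠ ε in nhdsWithin (0 : ℝ) (Ioi 0), ε ≤ 1 :=
    nhdsWithin_le_nhds ((eventually_lt_nhds (zero_lt_one' ℝ)).mono fun _ h => h.le)
  have hprim : Tendsto (fun ε => innerPrimitive s ε - innerPrimitive s (ε / (1 + ε)))
      (nhdsWithin 0 (Ioi 0)) (nhds 0) := by
    refine squeeze_zero_norm' ?_ hlim
    filter_upwards [self_mem_nhdsWithin, hone] with ε hε hε1
    exact abs_innerPrimitive_sub_le hs hs1 hε hε1
  have := hprim.sub (tendsto_explicitPrimitive hs hs1)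
  rw [sub_zero] at this
  refine this.congr' ?_
  filter_upwards [self_mem_nhdsWithin, hone] with ε hε hε1
  rw [← integral_Ioi_secondDiffPow hs hε hε1]
  refine setIntegral_congr_fun measurableSet_Ioi fun ρ hρ => ?_
  have hρ0 : ρ ∈ Ioi (0 : ℝ) := lt_trans (show (0 : ℝ) < ε from hε) hρ
  have := indicator_of_mem hρ0 fun ρ : ℝ => secondDiffPow s ρ * ρ ^ (-1 - 2 * s)
  exact this.symm

theorem integral_secondDiffPow_mul {s : ℝ} (hs : 0 < s) (hs1 : s < 1) (c : ℝ) :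
    ∫ r in Ioi (0 : ℝ), secondDiffPow s (r * c) * r ^ (-1 - 2 * s) = 0 := by
  rcases eq_or_ne c 0 with rfl | hc
  · simp [secondDiffPow_zero]
  have hc' : 0 < |c| := abs_pos.2 hc
  have h := integral_comp_mul_left_Ioi
    (fun r : ℝ => secondDiffPow s r * r ^ (-1 - 2 * s)) 0 hc'
  rw [mul_zero, integral_secondDiffPow_mul_rpow hs hs1, smul_zero] at h
  have h2 : ∫ r in Ioi (0 : ℝ), secondDiffPow s (|c| * r) * (|c| * r) ^ (-1 - 2 * s) =
      ∫ r in Ioi (0 : ℝ), |c| ^ (-1 - 2 * s) * (secondDiffPow s (r * c) * r ^ (-1 - 2 * s)) := by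
    refine setIntegral_congr_fun measurableSet_Ioi fun r hr => ?_
    have hr0 : 0 < r := hr
    have : secondDiffPow s (|c| * r) = secondDiffPow s (r * c) := by
      rw [← secondDiffPow_abs s (r * c), abs_mul, abs_of_pos hr0, mul_comm]
    simp only [this]
    rw [Real.mul_rpow hc'.le hr0.le]
    ring
  rw [h2, integral_const_mul] at h
  exact (mul_eq_zero.1 h).resolve_left (Real.rpow_pos_of_pos hc' _).ne'

section Polar

variable {E : Type*} [NormedAddCommGroup E] [NormedSpace ℝ E] [MeasurableSpace E] [BorelSpace E]
  [FiniteDimensional ℝ E] [Nontrivial E] (μ : Measure E) [μ.IsAddHaarMeasure]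

/-- A function all of whose radial integrals vanish has vanishing integral. -/
theorem integral_eq_zero_of_radial (f : E → ℝ)
    (h : ∀ θ : E, ∫ r in Ioi (0 : ℝ), r ^ (Module.finrank ℝ E - 1) * f (r • θ) = 0) :
    ∫ x, f x ∂μ = 0 := by
  have key : ∫ x, f x ∂μ = ∫ p : Metric.sphere (0 : E) 1 × Ioi (0 : ℝ), f (p.2.1 • p.1.1)
      ∂μ.toSphere.prod (Measure.volumeIoiPow (Module.finrank ℝ E - 1)) := by
    calc ∫ x, f x ∂μ = ∫ x : ({(0)}ᶜ : Set E), f x.1 ∂(μ.comap (↑)) := by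
          rw [integral_subtype_comap (measurableSet_singleton _).compl f,
            restrict_compl_singleton]
      _ = _ := by
          rw [← μ.measurePreserving_homeomorphUnitSphereProd.integral_comp
            (Homeomorph.measurableEmbedding _)]
          refine integral_congr_ae (.of_forall fun x => ?_)
          have hx : ‖x.1‖ ≠ 0 := norm_ne_zero_iff.2 x.2
          simp [smul_smul, hx]
  rw [key]
  by_cases hint : Integrable (fun p : Metric.sphere (0 : E) 1 × Ioi (0 : ℝ) => f (p.2.1 • p.1.1))
      (μ.toSphere.prod (Measure.volumeIoiPow (Module.finrank ℝ E - 1)))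
  swap
  · exact integral_undef hint
  rw [integral_prod _ hint]
  refine integral_eq_zero_of_ae (.of_forall fun θ => ?_)
  simp only [Measure.volumeIoiPow, ENNReal.ofReal, Pi.zero_apply]
  rw [integral_withDensity_eq_integral_smul (measurable_subtype_coe.pow_const _).real_toNNReal,
    integral_subtype_comap measurableSet_Ioi fun r : ℝ =>
      Real.toNNReal (r ^ (Module.finrank ℝ E - 1)) • f (r • θ.1)]
  refine Eq.trans ?_ (h θ.1)
  refine setIntegral_congr_fun measurableSet_Ioi fun r hr => ?_
  rw [NNReal.smul_def, Real.coe_toNNReal _ (pow_nonneg (le_of_lt hr) _), smul_eq_mul]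

theorem integral_secondDiffPow_comp_div_rpow {s : ℝ} (hs : 0 < s) (hs1 : s < 1) (l : E →L[ℝ] ℝ)
    {N : E → ℝ} (hN : ∀ z, 0 ≤ N z) (hNsmul : ∀ r : ℝ, 0 < r → ∀ z, N (r • z) = r * N z) :
    ∫ z, secondDiffPow s (l z) / N z ^ ((Module.finrank ℝ E : ℝ) + 2 * s) ∂μ = 0 := by
  refine integral_eq_zero_of_radial μ _ fun θ => ?_
  have hdim : 0 < Module.finrank ℝ E := Module.finrank_pos
  have : EqOn (fun r : ℝ => r ^ (Module.finrank ℝ E - 1) *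
        (secondDiffPow s (l (r • θ)) / N (r • θ) ^ ((Module.finrank ℝ E : ℝ) + 2 * s)))
      (fun r => (N θ ^ ((Module.finrank ℝ E : ℝ) + 2 * s))⁻¹ *
        (secondDiffPow s (r * l θ) * r ^ (-1 - 2 * s))) (Ioi 0) := by
    intro r hr
    have hr0 : 0 < r := hr
    have hpow : r ^ (Module.finrank ℝ E - 1) =
        r ^ ((Module.finrank ℝ E : ℝ) + 2 * s) * r ^ (-1 - 2 * s) := by
      rw [← Real.rpow_add hr0, ← Real.rpow_natCast, Nat.cast_pred hdim]
      ring_nf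
    simp only [map_smul, smul_eq_mul]
    rw [hNsmul r hr0, Real.mul_rpow hr0.le (hN θ), hpow]
    have := (Real.rpow_pos_of_pos hr0 ((Module.finrank ℝ E : ℝ) + 2 * s)).ne'
    field_simp
  rw [setIntegral_congr_fun measurableSet_Ioi this, integral_const_mul,
    integral_secondDiffPow_mul hs hs1, mul_zero]

theorem integrable_min_sq_rpow_mul_norm_rpow {s : ℝ} (hs : 0 < s) (hs1 : s < 1) :
    Integrable (fun z : E => min (‖z‖ ^ 2) (‖z‖ ^ s) *
      ‖z‖ ^ (-((Module.finrank ℝ E : ℝ) + 2 * s))) μ := by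
  have hdim : 0 < Module.finrank ℝ E := Module.finrank_pos
  refine (integrable_fun_norm_addHaar μ (f := fun r : ℝ => min (r ^ 2) (r ^ s) *
    r ^ (-((Module.finrank ℝ E : ℝ) + 2 * s)))).2 ?_
  refine (integrableOn_congr_fun (fun r hr => ?_) measurableSet_Ioi).2
    (integrableOn_min_sq_rpow_mul_rpow hs hs1)
  have hr0 : 0 < r := hr
  rw [smul_eq_mul, mul_left_comm, ← Real.rpow_natCast r (_ - 1), Nat.cast_pred hdim,
    ← Real.rpow_add hr0]
  ring_nf

theorem integrable_secondDiffPow_comp_div_rpow {s : ℝ} (hs : 0 < s) (hs1 : s < 1) (l : E →L[ℝ] ℝ)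
    {N : E → ℝ} (hN : ∀ z, ‖z‖ ≤ N z) (hNm : Measurable N) :
    Integrable (fun z => secondDiffPow s (l z) / N z ^ ((Module.finrank ℝ E : ℝ) + 2 * s)) μ := by
  refine ((integrable_min_sq_rpow_mul_norm_rpow μ hs hs1).const_mul
    (2 * (‖l‖ + 1) ^ 2)).mono' ?_ (.of_forall fun z => ?_)
  · exact (((continuous_secondDiffPow hs).measurable.comp l.continuous.measurable).div
      (hNm.pow_const _)).aestronglyMeasurable
  rcases eq_or_ne z 0 with rfl | hz
  · rw [map_zero, secondDiffPow_zero, zero_div, norm_zero, norm_zero]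
    positivity
  have hz0 : 0 < ‖z‖ := norm_pos_iff.2 hz
  have hN0 : 0 < N z := hz0.trans_le (hN z)
  have hl : |l z| ≤ (‖l‖ + 1) * ‖z‖ := by
    have := l.le_opNorm z
    rw [Real.norm_eq_abs] at this
    nlinarith [norm_nonneg z]
  have hC : 1 ≤ ‖l‖ + 1 := by linarith [norm_nonneg l]
  have hg : |secondDiffPow s (l z)| ≤
      2 * ((‖l‖ + 1) ^ 2 * min (‖z‖ ^ 2) (‖z‖ ^ s)) := by
    refine (abs_secondDiffPow_le hs hs1 _).trans ?_
    gcongr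
    rw [mul_min_of_nonneg _ _ (by positivity)]
    refine min_le_min ?_ ?_
    · rw [← mul_pow]
      gcongr
    · calc |l z| ^ s ≤ ((‖l‖ + 1) * ‖z‖) ^ s := by gcongr
        _ = (‖l‖ + 1) ^ s * ‖z‖ ^ s := Real.mul_rpow (by positivity) (by positivity)
        _ ≤ (‖l‖ + 1) ^ 2 * ‖z‖ ^ s := by
          gcongr
          rw [← Real.rpow_two]
          exact Real.rpow_le_rpow_of_exponent_le hC (by linarith)
  rw [norm_div, Real.norm_eq_abs, Real.norm_of_nonneg (by positivity), Real.rpow_neg hz0.le,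
    ← div_eq_mul_inv, mul_div_assoc', mul_assoc]
  gcongr
  exact hN z

end Polar

section Comparison

variable {E : Type*} [NormedAddCommGroup E] [NormedSpace ℝ E] [MeasurableSpace E] [BorelSpace E]
  [FiniteDimensional ℝ E] (μ : Measure E) [μ.IsAddHaarMeasure]

theorem integrableOn_div_rpow {κ ε : ℝ} (hκ : (Module.finrank ℝ E : ℝ) < κ) (hε : 0 < ε)
    {N : E → ℝ} (hN : ∀ z, ‖z‖ ≤ N z) (hNm : Measurable N) {v : E → ℝ} (hv : Measurable v)
    {B : ℝ} (hB : ∀ z, |v z| ≤ B) :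
    IntegrableOn (fun z => v z / N z ^ κ) {z | ε < N z} μ := by
  have hκ0 : 0 < κ := lt_of_le_of_lt (Nat.cast_nonneg _) hκ
  have hB0 : 0 ≤ B := (abs_nonneg _).trans (hB 0)
  refine ((integrable_one_add_norm (μ := μ) hκ).const_mul
    (B * (1 / ε + 1) ^ κ)).integrableOn.mono'
    (hv.div (hNm.pow_const _)).aestronglyMeasurable ?_
  filter_upwards [ae_restrict_mem (measurableSet_lt measurable_const hNm)] with z hz
  have hz : ε < N z := hz
  have hN0 : 0 < N z := hε.trans hz
  have h1 : 1 + ‖z‖ ≤ (1 / ε + 1) * N z := by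
    have : 1 ≤ 1 / ε * N z := by
      rw [one_div, inv_mul_eq_div, one_le_div hε]
      exact hz.le
    linarith [hN z]
  have h2 : (1 + ‖z‖) ^ κ ≤ (1 / ε + 1) ^ κ * N z ^ κ := by
    rw [← Real.mul_rpow (by positivity) hN0.le]
    exact Real.rpow_le_rpow (by positivity) h1 hκ0.le
  rw [norm_div, Real.norm_eq_abs, Real.norm_of_nonneg (by positivity), Real.rpow_neg (by positivity),
    ← div_eq_mul_inv, div_le_div_iff₀ (by positivity) (by positivity)]
  calc |v z| * (1 + ‖z‖) ^ κ ≤ B * ((1 / ε + 1) ^ κ * N z ^ κ) := by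
        gcongr
        exact hB z
    _ = _ := by ring

/-- The truncated integrals defining the fractional Laplacian of a half-space power at a point
at height `t` tend to zero. -/
theorem tendsto_halfSpace_truncated [Nontrivial E] {s t : ℝ} (hs : 0 < s) (hs1 : s < 1)
    (ht : 0 < t) (l : E →L[ℝ] ℝ) {N : E → ℝ} (hN : ∀ z, ‖z‖ ≤ N z) (hNm : Measurable N)
    (hNsmul : ∀ r : ℝ, 0 < r → ∀ z, N (r • z) = r * N z) (hNneg : ∀ z, N (-z) = N z)
    (hint : ∀ ε, 0 < ε → IntegrableOn (fun z => ((max (t + l z) 0) ^ s - t ^ s) /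
      N z ^ ((Module.finrank ℝ E : ℝ) + 2 * s)) {z | ε < N z} μ) :
    Tendsto (fun ε : ℝ => ∫ z in {z | ε < N z}, ((max (t + l z) 0) ^ s - t ^ s) /
      N z ^ ((Module.finrank ℝ E : ℝ) + 2 * s) ∂μ) (nhdsWithin 0 (Ioi 0)) (nhds 0) := by
  set κ := (Module.finrank ℝ E : ℝ) + 2 * s with hκ
  have hκ0 : 0 < κ := by positivity
  have hN0 : ∀ z, 0 ≤ N z := fun z => (norm_nonneg z).trans (hN z)
  set f : E → ℝ := fun z => ((max (t + l z) 0) ^ s - t ^ s) / N z ^ κ with hf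
  have hsum : ∀ z, f z + f (-z) = t ^ s * (secondDiffPow s ((t⁻¹ • l) z) / N z ^ κ) := by
    intro z
    have e : ∀ w : ℝ, (max (t + w) 0) ^ s = t ^ s * (max (1 + t⁻¹ * w) 0) ^ s := by
      intro w
      rw [← Real.mul_rpow ht.le (le_max_right _ _), mul_max_of_nonneg _ _ ht.le, mul_zero, mul_add,
        mul_one, mul_inv_cancel_left₀ ht.ne']
    simp only [hf, hNneg, map_neg, secondDiffPow, smul_apply, smul_eq_mul, e,
      mul_neg, ← sub_eq_add_neg]
    ring
  have hsymm : ∀ ε, 0 < ε → ∫ z in {z | ε < N z}, f z ∂μ =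
      t ^ s / 2 * ∫ z in {z | ε < N z}, secondDiffPow s ((t⁻¹ • l) z) / N z ^ κ ∂μ := by
    intro ε hε
    have hpre : (Neg.neg : E → E) ⁻¹' {z | ε < N z} = {z | ε < N z} := by
      ext z
      simp [hNneg]
    have hmp := (Measure.measurePreserving_neg μ).restrict_preimage
      (measurableSet_lt measurable_const hNm : MeasurableSet {z | ε < N z})
    rw [hpre] at hmp
    have hme : MeasurableEmbedding (Neg.neg : E → E) := (MeasurableEquiv.neg E).measurableEmbedding
    have hneg : ∫ z in {z | ε < N z}, f (-z) ∂μ = ∫ z in {z | ε < N z}, f z ∂μ :=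
      hmp.integral_comp hme f
    have hi : IntegrableOn (fun z => f (-z)) {z | ε < N z} μ :=
      (hmp.integrable_comp_emb hme).2 (hint ε hε)
    have hadd := integral_add (hint ε hε) hi
    rw [hneg] at hadd
    simp_rw [hsum] at hadd
    rw [integral_const_mul] at hadd
    linarith
  have hlim := (tendsto_setIntegral_lt hNm
    (integrable_secondDiffPow_comp_div_rpow μ hs hs1 (t⁻¹ • l) hN hNm) (fun z hz => by
      rw [le_antisymm hz (hN0 z), Real.zero_rpow hκ0.ne', div_zero])).const_mul (t ^ s / 2)
  rw [integral_secondDiffPow_comp_div_rpow μ hs hs1 (t⁻¹ • l) hN0 hNsmul, mul_zero] at hlim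
  refine hlim.congr' ?_
  filter_upwards [self_mem_nhdsWithin] with ε hε
  exact (hsymm ε hε).symm

/-- If a bounded function differs from a half-space power by an integrable amount (with respect to
the singular kernel), its principal value integral is the integral of the difference. -/
theorem tendsto_truncated_of_integrable_sub [Nontrivial E] {s t : ℝ} (hs : 0 < s) (hs1 : s < 1)
    (ht : 0 < t) (l : E →L[ℝ] ℝ) {N : E → ℝ} (hN : ∀ z, ‖z‖ ≤ N z) (hNm : Measurable N)
    (hNsmul : ∀ r : ℝ, 0 < r → ∀ z, N (r • z) = r * N z) (hNneg : ∀ z, N (-z) = N z)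
    {v : E → ℝ} (hv : Measurable v) {B : ℝ} (hB : ∀ z, |v z| ≤ B) (hv0 : v 0 = t ^ s)
    (hD : Integrable (fun z => (v z - (max (t + l z) 0) ^ s) /
      N z ^ ((Module.finrank ℝ E : ℝ) + 2 * s)) μ) :
    Tendsto (fun ε : ℝ => ∫ z in {z | ε < N z}, (v z - v 0) /
      N z ^ ((Module.finrank ℝ E : ℝ) + 2 * s) ∂μ) (nhdsWithin 0 (Ioi 0))
      (nhds (∫ z, (v z - (max (t + l z) 0) ^ s) /
        N z ^ ((Module.finrank ℝ E : ℝ) + 2 * s) ∂μ)) := by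
  have hκ0 : 0 < (Module.finrank ℝ E : ℝ) + 2 * s := by positivity
  have hint : ∀ ε, 0 < ε → IntegrableOn (fun z => ((max (t + l z) 0) ^ s - t ^ s) /
      N z ^ ((Module.finrank ℝ E : ℝ) + 2 * s)) {z | ε < N z} μ := by
    intro ε hε
    have h1 := integrableOn_div_rpow μ (κ := (Module.finrank ℝ E : ℝ) + 2 * s) (by linarith) hε hN
      hNm (hv.sub_const (v 0)) (B := B + B)
      (fun z => (abs_sub _ _).trans (add_le_add (hB z) (hB 0)))
    refine (h1.sub hD.integrableOn).congr (.of_forall fun z => ?_)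
    simp only [Pi.sub_apply, hv0]
    ring
  have h1 := tendsto_setIntegral_lt hNm hD (fun z hz => by
      rw [le_antisymm hz ((norm_nonneg z).trans (hN z)), Real.zero_rpow hκ0.ne', div_zero])
  have h2 := h1.add (tendsto_halfSpace_truncated μ hs hs1 ht l hN hNm hNsmul hNneg hint)
  rw [add_zero] at h2
  refine h2.congr' ?_
  filter_upwards [self_mem_nhdsWithin] with ε hε
  rw [← integral_add hD.integrableOn (hint ε hε)]
  refine integral_congr_ae (.of_forall fun z => ?_)
  simp only [hv0]
  ring

end Comparison

theorem rpow_max_add_le {s u e : ℝ} (hs : 0 < s) (hs1 : s < 1) (hu : u ≠ 0) (he : 0 ≤ e) :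
    (max (u + e) 0) ^ s ≤ (max u 0) ^ s + e * |u| ^ (s - 1) := by
  rcases lt_or_gt_of_ne hu with h | h
  · rw [max_eq_right h.le, Real.zero_rpow hs.ne', zero_add]
    rcases le_or_gt (u + e) 0 with h' | h'
    · rw [max_eq_right h', Real.zero_rpow hs.ne']
      positivity
    · have he0 : 0 < e := by linarith
      rw [max_eq_left h'.le, abs_of_neg h]
      calc (u + e) ^ s ≤ e ^ s := Real.rpow_le_rpow h'.le (by linarith) hs.le
        _ = e * e ^ (s - 1) := by rw [Real.rpow_sub_one he0.ne']; field_simp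
        _ ≤ e * (-u) ^ (s - 1) := mul_le_mul_of_nonneg_left
          (Real.rpow_le_rpow_of_nonpos (by linarith) (by linarith) (by linarith)) he
  · rw [max_eq_left h.le, max_eq_left (by linarith), abs_of_pos h]
    have h1 : u + e = u * (1 + e / u) := by field_simp
    have h2 := rpow_one_add_le_one_add_mul_self (s := e / u)
      (by linarith [div_nonneg he h.le]) hs.le hs1.le
    rw [h1, Real.mul_rpow h.le (by positivity), Real.rpow_sub_one h.ne']
    have hus : 0 < u ^ s := Real.rpow_pos_of_pos h s
    calc u ^ s * (1 + e / u) ^ s ≤ u ^ s * (1 + 1 * (e / u)) := by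
          gcongr
          refine h2.trans ?_
          gcongr
      _ = _ := by ring

theorem abs_rpow_max_add_sub_le {s u e : ℝ} (hs : 0 < s) (hs1 : s < 1) (hu : u ≠ 0)
    (he : 0 ≤ e) : |(max (u + e) 0) ^ s - (max u 0) ^ s| ≤ e * |u| ^ (s - 1) := by
  rw [abs_of_nonneg]
  · linarith [rpow_max_add_le hs hs1 hu he]
  · exact sub_nonneg.2 (Real.rpow_le_rpow (le_max_right _ _)
      (max_le_max_right _ (by linarith)) hs.le)

theorem rpow_neg_mul_rpow_neg_le_add {a b A B : ℝ} (ha : 0 < a) (hb : 0 < b) (hA : 0 ≤ A)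
    (hB : 0 ≤ B) : a ^ (-A) * b ^ (-B) ≤ a ^ (-(A + B)) + b ^ (-(A + B)) := by
  rcases le_total a b with h | h
  · have : b ^ (-B) ≤ a ^ (-B) := Real.rpow_le_rpow_of_nonpos ha h (by linarith)
    calc a ^ (-A) * b ^ (-B) ≤ a ^ (-A) * a ^ (-B) := by gcongr
      _ = a ^ (-(A + B)) := by rw [← Real.rpow_add ha]; ring_nf
      _ ≤ _ := le_add_of_nonneg_right (by positivity)
  · have : a ^ (-A) ≤ b ^ (-A) := Real.rpow_le_rpow_of_nonpos hb h (by linarith)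
    calc a ^ (-A) * b ^ (-B) ≤ b ^ (-A) * b ^ (-B) := by gcongr
      _ = b ^ (-(A + B)) := by rw [← Real.rpow_add hb]; ring_nf
      _ ≤ _ := le_add_of_nonneg_left (by positivity)

/-- Singular negative powers are integrable on intervals of fixed length, uniformly in the
position of the singularity. -/
theorem exists_setLIntegral_abs_add_rpow_le {γ : ℝ} (hγ0 : 0 ≤ γ) (hγ1 : γ < 1) (R : ℝ) :
    ∃ K : ENNReal, K ≠ ⊤ ∧ ∀ c : ℝ,
      ∫⁻ q in Metric.ball (0 : ℝ) R, ENNReal.ofReal (|q + c| ^ (-γ)) ≤ K := by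
  have hint : IntegrableOn (fun q : ℝ => |q| ^ (-γ)) (Metric.ball (0 : ℝ) 1) := by
    have := (integrableOn_fun_norm_addHaar (E := ℝ) volume (f := fun r => r ^ (-γ)) (r := 1)).2
    simp only [Module.finrank_self, tsub_self, pow_zero, one_smul, Real.norm_eq_abs] at this
    exact this ((intervalIntegral.integrableOn_Ioo_rpow_iff one_pos).2 (by linarith))
  refine ⟨(∫⁻ q in Metric.ball (0 : ℝ) 1, ENNReal.ofReal (|q| ^ (-γ))) +
    volume (Metric.ball (0 : ℝ) R), ENNReal.add_ne_top.2 ⟨?_, ?_⟩, fun c => ?_⟩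
  · exact hint.lintegral_lt_top.ne
  · exact measure_ball_lt_top.ne
  set g : ℝ → ENNReal :=
    (Metric.ball (0 : ℝ) 1).indicator fun q => ENNReal.ofReal (|q| ^ (-γ)) with hg
  have hgm : Measurable g := by
    refine Measurable.indicator ?_ measurableSet_ball
    fun_prop
  have hpt : ∀ q : ℝ, ENNReal.ofReal (|q + c| ^ (-γ)) ≤ g (q + c) + 1 := by
    intro q
    by_cases h : q + c ∈ Metric.ball (0 : ℝ) 1
    · rw [hg, indicator_of_mem h]
      exact le_self_add
    · rw [hg, indicator_of_notMem h, zero_add, ENNReal.ofReal_le_one]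
      rw [Metric.mem_ball, dist_zero_right, Real.norm_eq_abs, not_lt] at h
      exact Real.rpow_le_one_of_one_le_of_nonpos h (by linarith)
  calc _ ≤ ∫⁻ q in Metric.ball (0 : ℝ) R, (g (q + c) + 1) := lintegral_mono fun q => hpt q
    _ = (∫⁻ q in Metric.ball (0 : ℝ) R, g (q + c)) + volume (Metric.ball (0 : ℝ) R) := by
      rw [lintegral_add_right _ measurable_const, setLIntegral_one]
    _ ≤ (∫⁻ q, g (q + c)) + volume (Metric.ball (0 : ℝ) R) := by
      gcongr
      exact Measure.restrict_le_self
    _ = _ := by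
      rw [lintegral_add_right_eq_self g c, hg, lintegral_indicator measurableSet_ball]

theorem integrableOn_ball_norm_rpow_neg {F : Type*} [NormedAddCommGroup F] [NormedSpace ℝ F]
    [MeasurableSpace F] [BorelSpace F] [FiniteDimensional ℝ F] (μ : Measure F)
    [μ.IsAddHaarMeasure] {η : ℝ} (hη : η < Module.finrank ℝ F) (R : ℝ) :
    IntegrableOn (fun p : F => ‖p‖ ^ (-η)) (Metric.ball 0 R) μ := by
  rcases subsingleton_or_nontrivial F with h | h
  · have : (fun p : F => ‖p‖ ^ (-η)) = fun _ => ‖(0 : F)‖ ^ (-η) :=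
      funext fun p => by rw [Subsingleton.elim p 0]
    rw [this]
    exact integrableOn_const measure_ball_lt_top.ne
  · refine (integrableOn_fun_norm_addHaar μ (f := fun r => r ^ (-η)) (r := R)).2 ?_
    rcases le_or_gt R 0 with hR | hR
    · simp [Ioo_eq_empty (not_lt.2 hR)]
    refine (integrableOn_congr_fun (fun r hr => ?_) measurableSet_Ioo).1
      ((intervalIntegral.integrableOn_Ioo_rpow_iff
        (s := (Module.finrank ℝ F : ℝ) - 1 - η) hR).2 (by linarith))
    have hdim : 0 < Module.finrank ℝ F := Module.finrank_pos
    rw [smul_eq_mul, ← Real.rpow_natCast, Nat.cast_pred hdim, ← Real.rpow_add hr.1]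
    ring_nf

theorem integrableOn_compl_ball_norm_rpow_neg {F : Type*} [NormedAddCommGroup F]
    [NormedSpace ℝ F] [MeasurableSpace F] [BorelSpace F] [FiniteDimensional ℝ F]
    (μ : Measure F) [μ.IsAddHaarMeasure] {η R : ℝ} (hη : Module.finrank ℝ F < η) (hR : 0 < R) :
    IntegrableOn (fun p : F => ‖p‖ ^ (-η)) (Metric.ball 0 R)ᶜ μ := by
  have hη0 : 0 < η := lt_of_le_of_lt (Nat.cast_nonneg _) hη
  refine ((integrable_one_add_norm (μ := μ) hη).const_mul
    ((1 / R + 1) ^ η)).integrableOn.mono'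
    (by fun_prop : Measurable fun p : F => ‖p‖ ^ (-η)).aestronglyMeasurable ?_
  filter_upwards [ae_restrict_mem measurableSet_ball.compl] with z hz
  have hz : R ≤ ‖z‖ := by simpa using hz
  have hz0 : 0 < ‖z‖ := hR.trans_le hz
  have h1 : 1 + ‖z‖ ≤ (1 / R + 1) * ‖z‖ := by
    have : 1 ≤ 1 / R * ‖z‖ := by
      rw [one_div, inv_mul_eq_div, one_le_div hR]
      exact hz
    linarith
  have h2 : (1 + ‖z‖) ^ η ≤ (1 / R + 1) ^ η * ‖z‖ ^ η := by
    rw [← Real.mul_rpow (by positivity) hz0.le]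
    exact Real.rpow_le_rpow (by positivity) h1 hη0.le
  rw [Real.norm_of_nonneg (by positivity), Real.rpow_neg (by positivity),
    Real.rpow_neg (by positivity), ← div_eq_mul_inv, inv_eq_one_div,
    div_le_div_iff₀ (by positivity) (by positivity), one_mul]
  exact h2

section Product

variable {F : Type*} [NormedAddCommGroup F] [NormedSpace ℝ F] [MeasurableSpace F] [BorelSpace F]
  [FiniteDimensional ℝ F] (μ : Measure F) [μ.IsAddHaarMeasure]

/-- The kernel bound near the singularity, for a function whose graph deviates quadratically from
that of a half-space power. -/
theorem abs_rpow_sub_div_le {s M t a e N κ P : ℝ} (hs : 0 < s) (hs1 : s < 1)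
    (hP : 0 < P) (hM : 0 ≤ M) (hPN : P ≤ N) (haN : |a| ≤ 2 * N) (he : 0 ≤ e) (heM : e ≤ M * P ^ 2)
    (hu : t + a ≠ 0) (ha : a ≠ 0) (hκ : s ^ 2 ≤ κ) :
    |((max (t + a + e) 0) ^ s - (max (t + a) 0) ^ s) / N ^ κ| ≤
      M * 2 ^ (s ^ 2) * P ^ (-(κ - 2 - s ^ 2)) *
        (|a + t| ^ (-(1 - s + s ^ 2)) + |a + 0| ^ (-(1 - s + s ^ 2))) := by
  have hN : 0 < N := hP.trans_le hPN
  have hu' : 0 < |t + a| := abs_pos.2 hu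
  have ha' : 0 < |a| := abs_pos.2 ha
  have hβ : 0 < s ^ 2 := by positivity
  have hNκ : P ^ (κ - s ^ 2) * (|a| / 2) ^ (s ^ 2) ≤ N ^ κ := by
    calc _ ≤ N ^ (κ - s ^ 2) * N ^ (s ^ 2) := by
          gcongr
          linarith
      _ = N ^ κ := by rw [← Real.rpow_add hN]; ring_nf
  have hprod := rpow_neg_mul_rpow_neg_le_add hu' ha' (show 0 ≤ 1 - s by linarith) hβ.le
  rw [abs_div, abs_of_pos (Real.rpow_pos_of_pos hN κ)]
  calc _ ≤ (M * P ^ 2 * |t + a| ^ (s - 1)) / (P ^ (κ - s ^ 2) * (|a| / 2) ^ (s ^ 2)) := by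
        gcongr
        exact (abs_rpow_max_add_sub_le hs hs1 hu he).trans (by gcongr)
    _ = M * 2 ^ (s ^ 2) * P ^ (-(κ - 2 - s ^ 2)) * (|t + a| ^ (-(1 - s)) * |a| ^ (-(s ^ 2))) := by
      have hPp : P ^ (-(κ - 2 - s ^ 2)) = P ^ 2 / P ^ (κ - s ^ 2) := by
        rw [← Real.rpow_two P, ← Real.rpow_sub hP]
        ring_nf
      rw [Real.div_rpow ha'.le (by norm_num), Real.rpow_neg ha'.le, hPp, neg_sub]
      field_simp
    _ ≤ _ := by
      rw [add_zero, add_comm a t]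
      gcongr

/-- Near the singularity, the deviation from a half-space power is integrable against the kernel,
uniformly in the height `t` and the direction `c`. -/
theorem exists_lintegral_near_le {s M R : ℝ} (hs : 0 < s) (hs1 : s < 1) (hM : 0 ≤ M) :
    ∃ K : ENNReal, K ≠ ⊤ ∧ ∀ (t : ℝ) (c : F → ℝ) (N f : F × ℝ → ℝ), Measurable f →
      (∀ z, ‖z‖ ≤ N z) → (∀ z, |z.2 + c z.1| ≤ 2 * N z) →
      (∀ z ∈ Metric.ball (0 : F × ℝ) R, ∃ e, 0 ≤ e ∧ e ≤ M * ‖z.1‖ ^ 2 ∧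
        f z = ((max (t + (z.2 + c z.1) + e) 0) ^ s - (max (t + (z.2 + c z.1)) 0) ^ s) /
          N z ^ ((Module.finrank ℝ F : ℝ) + 1 + 2 * s)) →
      ∫⁻ z in Metric.ball (0 : F × ℝ) R, ENNReal.ofReal |f z| ∂(μ.prod volume) ≤ K := by
  obtain ⟨K, hK, hKb⟩ := exists_setLIntegral_abs_add_rpow_le (γ := 1 - s + s ^ 2)
    (by nlinarith) (by nlinarith) R
  set n : ℝ := (Module.finrank ℝ F : ℝ) with hn
  have hn0 : 0 ≤ n := Nat.cast_nonneg _
  set κ : ℝ := n + 1 + 2 * s with hκ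
  have hint := ((integrableOn_ball_norm_rpow_neg μ (η := κ - 2 - s ^ 2)
    (by rw [hκ]; nlinarith) R).const_mul (M * 2 ^ (s ^ 2))).lintegral_lt_top
  refine ⟨(∫⁻ p in Metric.ball (0 : F) R,
    ENNReal.ofReal (M * 2 ^ (s ^ 2) * ‖p‖ ^ (-(κ - 2 - s ^ 2))) ∂μ) * (K + K),
    ENNReal.mul_ne_top hint.ne (ENNReal.add_ne_top.2 ⟨hK, hK⟩), ?_⟩
  intro t c N f hf hN hcN hfe
  rw [← lintegral_mul_const' _ _ (ENNReal.add_ne_top.2 ⟨hK, hK⟩),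
    show (0 : F × ℝ) = ((0 : F), (0 : ℝ)) from rfl, ← ball_prod_same, ← Measure.prod_restrict,
    lintegral_prod _ (by fun_prop)]
  refine setLIntegral_mono' measurableSet_ball fun p hp => ?_
  have hzero : ∀ C : ℝ, ∀ᵐ q : ℝ, q ≠ C := fun C => by
    simp [ae_iff]
  calc ∫⁻ q in Metric.ball (0 : ℝ) R, ENNReal.ofReal |f (p, q)|
      ≤ ∫⁻ q in Metric.ball (0 : ℝ) R,
        ENNReal.ofReal (M * 2 ^ (s ^ 2) * ‖p‖ ^ (-(κ - 2 - s ^ 2))) *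
          (ENNReal.ofReal (|q + (c p + t)| ^ (-(1 - s + s ^ 2))) +
            ENNReal.ofReal (|q + c p| ^ (-(1 - s + s ^ 2)))) := by
        refine lintegral_mono_ae ?_
        filter_upwards [ae_restrict_mem measurableSet_ball,
          ae_restrict_of_ae (hzero (-(t + c p))), ae_restrict_of_ae (hzero (-c p))]
          with q hq hq1 hq2
        obtain ⟨e, he0, heM, hfz⟩ := hfe (p, q) (by
          rw [show (0 : F × ℝ) = ((0 : F), (0 : ℝ)) from rfl, ← ball_prod_same]
          exact ⟨hp, hq⟩)
        rw [← ENNReal.ofReal_add (by positivity) (by positivity),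
          ← ENNReal.ofReal_mul (by positivity)]
        refine ENNReal.ofReal_le_ofReal ?_
        rcases eq_or_ne p 0 with rfl | hp0
        · have : e = 0 := by
            simp only [norm_zero] at heM
            linarith
          rw [hfz, this, add_zero, sub_self, zero_div, abs_zero]
          positivity
        rw [hfz]
        refine (abs_rpow_sub_div_le hs hs1 (norm_pos_iff.2 hp0) hM
          ((norm_fst_le (p, q)).trans (hN _)) (hcN _) he0 heM ?_ ?_ ?_).trans_eq ?_
        · exact fun h => hq1 (by linarith)
        · exact fun h => hq2 (by linarith)
        · nlinarith
        · rw [add_zero, add_assoc]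
    _ = ENNReal.ofReal (M * 2 ^ (s ^ 2) * ‖p‖ ^ (-(κ - 2 - s ^ 2))) *
        ((∫⁻ q in Metric.ball (0 : ℝ) R,
          ENNReal.ofReal (|q + (c p + t)| ^ (-(1 - s + s ^ 2)))) +
        ∫⁻ q in Metric.ball (0 : ℝ) R, ENNReal.ofReal (|q + c p| ^ (-(1 - s + s ^ 2)))) := by
        rw [lintegral_const_mul' _ _ ENNReal.ofReal_ne_top, lintegral_add_left (by fun_prop)]
    _ ≤ _ := by
        gcongr
        · exact hKb _
        · exact hKb _

end Product

section Geometry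

variable {m : ℕ}

theorem enorm'_eq_norm (y : EuclideanSpace ℝ (Fin m) × ℝ) : enorm' y = ‖WithLp.toLp 2 y‖ := by
  rw [WithLp.prod_norm_eq_of_L2, enorm']
  simp

theorem enorm'_neg (y : EuclideanSpace ℝ (Fin m) × ℝ) : enorm' (-y) = enorm' y := by
  simp [enorm']

theorem enorm'_smul {r : ℝ} (hr : 0 < r) (y : EuclideanSpace ℝ (Fin m) × ℝ) :
    enorm' (r • y) = r * enorm' y := by
  rw [enorm'_eq_norm, enorm'_eq_norm, WithLp.toLp_smul, norm_smul, Real.norm_of_nonneg hr.le]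

theorem enorm'_add_le (y z : EuclideanSpace ℝ (Fin m) × ℝ) :
    enorm' (y + z) ≤ enorm' y + enorm' z := by
  simp only [enorm'_eq_norm, WithLp.toLp_add]
  exact norm_add_le _ _

theorem norm_le_enorm' (y : EuclideanSpace ℝ (Fin m) × ℝ) : ‖y‖ ≤ enorm' y := by
  rw [Prod.norm_def, enorm']
  refine max_le (Real.le_sqrt_of_sq_le (by nlinarith [sq_nonneg y.2]))
    (Real.le_sqrt_of_sq_le ?_)
  rw [Real.norm_eq_abs, sq_abs]
  nlinarith [sq_nonneg ‖y.1‖]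

theorem enorm'_le_two_mul_norm (y : EuclideanSpace ℝ (Fin m) × ℝ) : enorm' y ≤ 2 * ‖y‖ := by
  have h1 := norm_fst_le y
  have h2 := norm_snd_le y
  rw [Real.norm_eq_abs] at h2
  rw [enorm']
  refine Real.sqrt_le_iff.2 ⟨by positivity, ?_⟩
  rw [← sq_abs y.2]
  nlinarith [norm_nonneg y.1, abs_nonneg y.2]

theorem measurable_enorm' :
    Measurable (enorm' : EuclideanSpace ℝ (Fin m) × ℝ → ℝ) := by
  unfold enorm'
  fun_prop

theorem snd_le_enorm' (y : EuclideanSpace ℝ (Fin m) × ℝ) : y.2 ≤ enorm' y := by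
  have := norm_snd_le y
  rw [Real.norm_eq_abs] at this
  exact (le_abs_self _).trans (this.trans (norm_le_enorm' y))

/-- The second-order Taylor bound for the sphere of radius `r`, as a graph. -/
theorem sqrt_sub_sqrt_bounds {F : Type*} [NormedAddCommGroup F] [InnerProductSpace ℝ F] {r : ℝ}
    (hr : 0 < r) {a p : F} (ha : ‖a‖ < r / 4) (hp : ‖p‖ < r / 8) :
    0 ≤ √(r ^ 2 - ‖a‖ ^ 2) - inner ℝ a p / √(r ^ 2 - ‖a‖ ^ 2) - √(r ^ 2 - ‖a + p‖ ^ 2) ∧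
    √(r ^ 2 - ‖a‖ ^ 2) - inner ℝ a p / √(r ^ 2 - ‖a‖ ^ 2) - √(r ^ 2 - ‖a + p‖ ^ 2) ≤
      4 / r * ‖p‖ ^ 2 := by
  have ha0 := norm_nonneg a
  have hp0 := norm_nonneg p
  have hap : ‖a + p‖ ≤ ‖a‖ + ‖p‖ := norm_add_le a p
  have hap0 := norm_nonneg (a + p)
  have hexp : ‖a + p‖ ^ 2 = ‖a‖ ^ 2 + 2 * inner ℝ a p + ‖p‖ ^ 2 := norm_add_sq_real a p
  have hi : |inner ℝ a p| ≤ ‖a‖ * ‖p‖ := abs_real_inner_le_norm a p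
  set i : ℝ := inner ℝ a p
  have hk2 : √(r ^ 2 - ‖a‖ ^ 2) ^ 2 = r ^ 2 - ‖a‖ ^ 2 := Real.sq_sqrt (by nlinarith)
  have hk'2 : √(r ^ 2 - ‖a + p‖ ^ 2) ^ 2 = r ^ 2 - ‖a + p‖ ^ 2 := Real.sq_sqrt (by nlinarith)
  have hk : r / 2 ≤ √(r ^ 2 - ‖a‖ ^ 2) := Real.le_sqrt_of_sq_le (by nlinarith)
  have hk' : r / 2 ≤ √(r ^ 2 - ‖a + p‖ ^ 2) := Real.le_sqrt_of_sq_le (by nlinarith)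
  set k := √(r ^ 2 - ‖a‖ ^ 2)
  set k' := √(r ^ 2 - ‖a + p‖ ^ 2)
  have hkpos : 0 < k := by linarith
  have hak : ‖a‖ ≤ k := by linarith
  have hj : |i / k| ≤ ‖p‖ := by
    rw [abs_div, abs_of_pos hkpos, div_le_iff₀ hkpos]
    nlinarith
  have hjk : i / k * k = i := by field_simp
  set j := i / k
  have hj' := abs_le.1 hj
  have hj2 : j ^ 2 ≤ ‖p‖ ^ 2 := by
    rw [← sq_abs]
    gcongr
  have hT : 0 < k - j := by linarith [hj'.2]
  have hdiff : (k - j - k') * (k - j + k') = ‖p‖ ^ 2 + j ^ 2 := by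
    have : (k - j - k') * (k - j + k') = k ^ 2 - 2 * (j * k) + j ^ 2 - k' ^ 2 := by ring
    rw [this, hk2, hk'2, hjk, hexp]
    ring
  have h0 : 0 ≤ k - j - k' := by
    by_contra! h
    nlinarith [sq_nonneg ‖p‖, sq_nonneg j]
  refine ⟨h0, ?_⟩
  have : (k - j - k') * (r / 2) ≤ 2 * ‖p‖ ^ 2 := by nlinarith
  rw [div_mul_eq_mul_div, le_div_iff₀ hr]
  linarith

theorem lt_enorm'_iff {r : ℝ} (hr : 0 < r) {y : EuclideanSpace ℝ (Fin m) × ℝ} (hy : 0 < y.2) :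
    r < enorm' y ↔ √(r ^ 2 - ‖y.1‖ ^ 2) < y.2 := by
  rw [enorm', Real.lt_sqrt hr.le, Real.sqrt_lt' hy, sub_lt_iff_lt_add']

end Geometry

section Barrier

variable {d : ℕ}

theorem measurable_hfun (r p : ℝ) : Measurable (hfun d r p) := by
  unfold hfun
  have hn := measurable_enorm' (m := d - 1)
  refine Measurable.ite ?_ (by fun_prop) measurable_const
  exact (measurableSet_lt measurable_const hn).inter ((measurableSet_lt hn measurable_const).inter
    ((measurableSet_lt measurable_const measurable_snd).inter
      (measurableSet_lt (measurable_fst.norm) measurable_const)))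

theorem hfun_nonneg {r p : ℝ} (hr : 0 < r) (y) : 0 ≤ hfun d r p y := by
  unfold hfun
  split_ifs with h
  · exact Real.rpow_nonneg (sub_nonneg.2 ((lt_enorm'_iff hr h.2.2.1).1 h.1).le) _
  · exact le_rfl

theorem hfun_le {r p : ℝ} (hr : 0 < r) (hp : 0 ≤ p) (y) : hfun d r p y ≤ (3 * r / 2) ^ p := by
  unfold hfun
  split_ifs with h
  · refine Real.rpow_le_rpow (sub_nonneg.2 ((lt_enorm'_iff hr h.2.2.1).1 h.1).le) ?_ hp
    linarith [Real.sqrt_nonneg (r ^ 2 - ‖y.1‖ ^ 2), snd_le_enorm' y, h.2.1]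
  · positivity

theorem hfun_eq {r p : ℝ} (hr : 0 < r) (hp : 0 < p)
    {y : EuclideanSpace ℝ (Fin (d - 1)) × ℝ} (h1 : enorm' y < 3 * r / 2) (h2 : 0 < y.2)
    (h3 : ‖y.1‖ < r / 2) :
    hfun d r p y = (max (y.2 - √(r ^ 2 - ‖y.1‖ ^ 2)) 0) ^ p := by
  unfold hfun
  by_cases h : r < enorm' y
  · rw [if_pos ⟨h, h1, h2, h3⟩, max_eq_left (sub_nonneg.2 ((lt_enorm'_iff hr h2).1 h).le)]
  · rw [if_neg fun h' => h h'.1, max_eq_right, Real.zero_rpow hp.ne']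
    exact sub_nonpos.2 (not_lt.1 fun h' => h ((lt_enorm'_iff hr h2).2 h'))

/-- The linear part at `a` of the defining function `y ↦ y.2 - √(r ^ 2 - ‖y.1‖ ^ 2)`. -/
noncomputable def tangentForm (r : ℝ) (a : EuclideanSpace ℝ (Fin (d - 1))) :
    EuclideanSpace ℝ (Fin (d - 1)) × ℝ →L[ℝ] ℝ :=
  ContinuousLinearMap.snd ℝ _ _ +
    ((√(r ^ 2 - ‖a‖ ^ 2))⁻¹ • innerSL ℝ a).comp (ContinuousLinearMap.fst ℝ _ _)

theorem tangentForm_apply (r : ℝ) (a : EuclideanSpace ℝ (Fin (d - 1))) (z) :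
    tangentForm r a z = z.2 + inner ℝ a z.1 / √(r ^ 2 - ‖a‖ ^ 2) := by
  simp [tangentForm, div_eq_inv_mul]

theorem abs_tangentForm_le {r : ℝ} (hr : 0 < r) {a : EuclideanSpace ℝ (Fin (d - 1))}
    (ha : ‖a‖ < r / 4) (z) : |tangentForm r a z| ≤ 2 * ‖z‖ := by
  have ha0 := norm_nonneg a
  have hk : r / 2 ≤ √(r ^ 2 - ‖a‖ ^ 2) := Real.le_sqrt_of_sq_le (by nlinarith)
  have hkpos : 0 < √(r ^ 2 - ‖a‖ ^ 2) := by linarith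
  have hj : |inner ℝ a z.1 / √(r ^ 2 - ‖a‖ ^ 2)| ≤ ‖z.1‖ := by
    rw [abs_div, abs_of_pos hkpos, div_le_iff₀ hkpos]
    have := abs_real_inner_le_norm a z.1
    nlinarith [norm_nonneg z.1]
  have h2 := norm_snd_le z
  rw [Real.norm_eq_abs] at h2
  rw [tangentForm_apply]
  exact (abs_add_le _ _).trans (by linarith [norm_fst_le z])

/-- The points at which the fractional Laplacian is estimated. -/
structure IsNearSphere (r : ℝ) (x : EuclideanSpace ℝ (Fin (d - 1)) × ℝ) : Prop where
  snd_pos : 0 < x.2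
  lt_enorm' : r < enorm' x
  enorm'_lt : enorm' x < r + r / 4
  norm_fst_lt : ‖x.1‖ < r / 4

variable {r s : ℝ} {x : EuclideanSpace ℝ (Fin (d - 1)) × ℝ}

theorem hfun_add_eq (hr : 0 < r) (hs : 0 < s) (hx : IsNearSphere r x)
    {z : EuclideanSpace ℝ (Fin (d - 1)) × ℝ} (hz : ‖z‖ < r / 8) :
    ∃ e, 0 ≤ e ∧ e ≤ 4 / r * ‖z.1‖ ^ 2 ∧ hfun d r s (x + z) =
      (max (x.2 - √(r ^ 2 - ‖x.1‖ ^ 2) + tangentForm r x.1 z + e) 0) ^ s := by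
  have hz1 : ‖z.1‖ < r / 8 := (norm_fst_le z).trans_lt hz
  have hz2 : |z.2| < r / 8 := (norm_snd_le z).trans_lt hz
  have ha0 := norm_nonneg x.1
  have ha := hx.norm_fst_lt
  have hk : r / 2 ≤ √(r ^ 2 - ‖x.1‖ ^ 2) := Real.le_sqrt_of_sq_le (by nlinarith)
  have hxk := (lt_enorm'_iff hr hx.snd_pos).1 hx.lt_enorm'
  obtain ⟨h1, h2⟩ := sqrt_sub_sqrt_bounds hr hx.norm_fst_lt hz1
  refine ⟨_, h1, h2, ?_⟩
  rw [hfun_eq hr hs]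
  · rw [tangentForm_apply, Prod.fst_add, Prod.snd_add]
    ring_nf
  · have := enorm'_add_le x z
    linarith [hx.enorm'_lt, enorm'_le_two_mul_norm z]
  · rw [Prod.snd_add]
    linarith [(abs_lt.1 hz2).1]
  · rw [Prod.fst_add]
    linarith [norm_add_le x.1 z.1]

theorem hfun_self (hr : 0 < r) (hs : 0 < s) (hx : IsNearSphere r x) :
    hfun d r s x = (x.2 - √(r ^ 2 - ‖x.1‖ ^ 2)) ^ s := by
  have hxk := (lt_enorm'_iff hr hx.snd_pos).1 hx.lt_enorm'
  rw [hfun_eq hr hs (by linarith [hx.enorm'_lt]) hx.snd_pos (by linarith [hx.norm_fst_lt]),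
    max_eq_left (by linarith)]

theorem abs_hfun_sub_le (hr : 0 < r) (hs : 0 < s) (hx : IsNearSphere r x)
    {z : EuclideanSpace ℝ (Fin (d - 1)) × ℝ} (hz : r / 8 ≤ ‖z‖) :
    |hfun d r s (x + z) -
      (max (x.2 - √(r ^ 2 - ‖x.1‖ ^ 2) + tangentForm r x.1 z) 0) ^ s| ≤ (18 * ‖z‖) ^ s := by
  have h1 : hfun d r s (x + z) ≤ (18 * ‖z‖) ^ s :=
    (hfun_le hr hs.le _).trans (Real.rpow_le_rpow (by positivity) (by linarith) hs.le)
  have h2 : (max (x.2 - √(r ^ 2 - ‖x.1‖ ^ 2) + tangentForm r x.1 z) 0) ^ s ≤ (18 * ‖z‖) ^ s := by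
    refine Real.rpow_le_rpow (le_max_right _ _) (max_le ?_ (by positivity)) hs.le
    linarith [Real.sqrt_nonneg (r ^ 2 - ‖x.1‖ ^ 2), snd_le_enorm' x, hx.enorm'_lt,
      (abs_le.1 (abs_tangentForm_le hr hx.norm_fst_lt z)).2]
  have h3 := hfun_nonneg (d := d) (p := s) hr (x + z)
  have h4 : 0 ≤ (max (x.2 - √(r ^ 2 - ‖x.1‖ ^ 2) + tangentForm r x.1 z) 0) ^ s :=
    Real.rpow_nonneg (le_max_right _ _) _
  rw [abs_le]
  constructor <;> linarith

/-- The difference between `hfun` and the half-space power tangent to it, divided by the kernel. -/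
noncomputable def barrierDefect (r s : ℝ) (x z : EuclideanSpace ℝ (Fin (d - 1)) × ℝ) : ℝ :=
  (hfun d r s (x + z) - (max (x.2 - √(r ^ 2 - ‖x.1‖ ^ 2) + tangentForm r x.1 z) 0) ^ s) /
    enorm' z ^ ((Module.finrank ℝ (EuclideanSpace ℝ (Fin (d - 1)) × ℝ) : ℝ) + 2 * s)

theorem measurable_barrierDefect : Measurable (barrierDefect r s x) := by
  unfold barrierDefect
  have h1 : Measurable fun z => hfun d r s (x + z) :=
    (measurable_hfun r s).comp (measurable_const_add x)
  have h2 : Measurable (tangentForm r x.1) := (tangentForm r x.1).continuous.measurable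
  have h3 := measurable_enorm' (m := d - 1)
  fun_prop

instance volume_prod_isAddHaarMeasure {m : ℕ} :
    (volume : Measure (EuclideanSpace ℝ (Fin m) × ℝ)).IsAddHaarMeasure :=
  inferInstanceAs (Measure.prod volume volume).IsAddHaarMeasure

theorem exists_lintegral_barrierDefect_le (d : ℕ) {r s : ℝ} (hr : 0 < r) (hs : 0 < s)
    (hs1 : s < 1) : ∃ K : ENNReal, K ≠ ⊤ ∧
      ∀ x : EuclideanSpace ℝ (Fin (d - 1)) × ℝ, IsNearSphere r x →
        ∫⁻ z, ENNReal.ofReal |barrierDefect r s x z| ≤ K := by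
  obtain ⟨K, hK, hKb⟩ := exists_lintegral_near_le
    (volume : Measure (EuclideanSpace ℝ (Fin (d - 1)))) (R := r / 8) hs hs1
    (show 0 ≤ 4 / r by positivity)
  set n : ℝ := (Module.finrank ℝ (EuclideanSpace ℝ (Fin (d - 1)) × ℝ) : ℝ) with hn
  have hn' : n = (Module.finrank ℝ (EuclideanSpace ℝ (Fin (d - 1))) : ℝ) + 1 := by
    rw [hn, Module.finrank_prod, Module.finrank_self]
    push_cast
    rfl
  have hn0 : 0 ≤ n := Nat.cast_nonneg _
  have hint := ((integrableOn_compl_ball_norm_rpow_neg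
    (volume : Measure (EuclideanSpace ℝ (Fin (d - 1)) × ℝ)) (η := n + s) (R := r / 8)
    (by linarith) (by positivity)).const_mul (18 ^ s)).lintegral_lt_top
  refine ⟨K + _, ENNReal.add_ne_top.2 ⟨hK, hint.ne⟩, fun x hx => ?_⟩
  rw [← lintegral_add_compl _ (measurableSet_ball (x := 0) (ε := r / 8))]
  refine add_le_add ?_ (setLIntegral_mono' measurableSet_ball.compl fun z hz => ?_)
  · refine hKb (x.2 - √(r ^ 2 - ‖x.1‖ ^ 2)) (fun p => inner ℝ x.1 p / √(r ^ 2 - ‖x.1‖ ^ 2)) enorm'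
      (barrierDefect r s x) measurable_barrierDefect norm_le_enorm' (fun z => ?_) fun z hz => ?_
    · rw [← tangentForm_apply]
      exact (abs_tangentForm_le hr hx.norm_fst_lt z).trans (by linarith [norm_le_enorm' z])
    · obtain ⟨e, he0, heM, he⟩ := hfun_add_eq hr hs hx (z := z) (by simpa using hz)
      refine ⟨e, he0, heM, ?_⟩
      rw [barrierDefect, he, ← hn, hn', tangentForm_apply]
  · have hz : r / 8 ≤ ‖z‖ := by simpa using hz
    have hz0 : 0 < ‖z‖ := by linarith
    refine ENNReal.ofReal_le_ofReal ?_
    have hN : ‖z‖ ^ (n + 2 * s) ≤ enorm' z ^ (n + 2 * s) :=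
      Real.rpow_le_rpow hz0.le (norm_le_enorm' z) (by linarith)
    have hN0 : 0 < enorm' z := hz0.trans_le (norm_le_enorm' z)
    rw [barrierDefect, abs_div, abs_of_pos (Real.rpow_pos_of_pos hN0 _)]
    calc _ ≤ (18 * ‖z‖) ^ s / ‖z‖ ^ (n + 2 * s) := by
          gcongr
          exact abs_hfun_sub_le hr hs hx hz
      _ = 18 ^ s * ‖z‖ ^ (-(n + s)) := by
        rw [Real.mul_rpow (by norm_num) hz0.le, mul_div_assoc, ← Real.rpow_sub hz0]
        ring_nf

theorem integrable_barrierDefect {K : ENNReal} (hK : K ≠ ⊤)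
    (h : ∫⁻ z, ENNReal.ofReal |barrierDefect r s x z| ≤ K) :
    Integrable (barrierDefect r s x) := by
  refine ⟨measurable_barrierDefect.aestronglyMeasurable, ?_⟩
  rw [hasFiniteIntegral_iff_norm]
  exact h.trans_lt hK.lt_top

theorem abs_integral_barrierDefect_le {K : ENNReal} (hK : K ≠ ⊤)
    (h : ∫⁻ z, ENNReal.ofReal |barrierDefect r s x z| ≤ K) :
    |∫ z, barrierDefect r s x z| ≤ K.toReal := by
  refine (norm_integral_le_lintegral_norm (barrierDefect r s x)).trans ?_
  exact ENNReal.toReal_mono hK h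

theorem pvInt2_eq (d : ℕ) (α : ℝ) (u : EuclideanSpace ℝ (Fin (d - 1)) × ℝ → ℝ) (x) (ε : ℝ) :
    pvInt2 d α u x ε =
      ∫ z in {z | ε < enorm' z}, (u (x + z) - u x) / enorm' z ^ ((d : ℝ) + α) := by
  have hmp := (measurePreserving_add_left
    (volume : Measure (EuclideanSpace ℝ (Fin (d - 1)) × ℝ)) x).restrict_preimage
    (measurableSet_lt measurable_const (measurable_enorm'.comp (measurable_sub_const x)) :
      MeasurableSet {y | ε < enorm' (y - x)})
  have := hmp.integral_comp (MeasurableEquiv.addLeft x).measurableEmbedding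
    (fun y => (u y - u x) / enorm' (x - y) ^ ((d : ℝ) + α))
  rw [pvInt2, ← this]
  simp [enorm'_neg]

end Barrier

/-- There exist `δ ∈ (0, r₁/4]` and a constant `C > 0` such that for every `y` with
`y_d > 0`, `r₁ < |y| < r₁ + δ`, `|ỹ| < r₁/4`, the principal value limit defining
`Δ^{α/2} h_{α/2}(y)` exists and `|Δ^{α/2} h_{α/2}(y)| ≤ C`. -/
theorem statement8 (d : ℕ) (hd : 1 ≤ d) (α : ℝ) (hα : α ∈ Set.Ioo (0 : ℝ) 2)
    (r1 : ℝ) (hr1 : r1 ∈ Set.Ioc (0 : ℝ) (1 / 2)) :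
    ∃ δ ∈ Set.Ioc (0 : ℝ) (r1 / 4), ∃ C : ℝ, 0 < C ∧
      ∀ y : EuclideanSpace ℝ (Fin (d - 1)) × ℝ,
        0 < y.2 → r1 < enorm' y → enorm' y < r1 + δ → ‖y.1‖ < r1 / 4 →
        ∃ L : ℝ,
          Filter.Tendsto (pvInt2 d α (hfun d r1 (α / 2)) y)
            (nhdsWithin 0 (Set.Ioi 0)) (nhds L) ∧
          |fracConst d α * L| ≤ C := by
  have hr : 0 < r1 := hr1.1
  have hs : 0 < α / 2 := half_pos hα.1
  have hs1 : α / 2 < 1 := by linarith [hα.2]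
  obtain ⟨K, hK, hKb⟩ := exists_lintegral_barrierDefect_le d hr hs hs1
  refine ⟨r1 / 4, ⟨by positivity, le_rfl⟩, |fracConst d α| * K.toReal + 1, by positivity, ?_⟩
  intro x hx2 hx hxδ hx1
  have hxn : IsNearSphere r1 x := ⟨hx2, hx, hxδ, hx1⟩
  refine ⟨∫ z, barrierDefect r1 (α / 2) x z, ?_, ?_⟩
  · have hκ : (Module.finrank ℝ (EuclideanSpace ℝ (Fin (d - 1)) × ℝ) : ℝ) + 2 * (α / 2) =
        d + α := by
      rw [Module.finrank_prod, Module.finrank_self, finrank_euclideanSpace_fin,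
        Nat.sub_add_cancel hd]
      ring
    have h := tendsto_truncated_of_integrable_sub volume hs hs1
      (sub_pos.2 ((lt_enorm'_iff hr hx2).1 hx)) (tangentForm r1 x.1) norm_le_enorm'
      measurable_enorm' (fun _ h => enorm'_smul h) enorm'_neg
      (v := fun z => hfun d r1 (α / 2) (x + z))
      ((measurable_hfun _ _).comp (measurable_const_add x)) (B := (3 * r1 / 2) ^ (α / 2))
      (fun z => by
        rw [abs_of_nonneg (hfun_nonneg hr _)]
        exact hfun_le hr hs.le _)
      (by rw [add_zero, hfun_self hr hs hxn])
      (integrable_barrierDefect hK (hKb x hxn))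
    rw [hκ] at h
    refine Tendsto.congr (fun ε => ?_) (h.trans_eq ?_)
    · rw [pvInt2_eq, add_zero]
    · simp only [barrierDefect, hκ]
  · rw [abs_mul]
    have := abs_integral_barrierDefect_le hK (hKb x hxn)
    nlinarith [abs_nonneg (fracConst d α)]
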